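/- Let K_1 ⊆ K_2 be convex bodies in ℝ^n, each admitting at least one periodic billiard trajectory. Then μ_P(K_1) ≤ μ_P(K_2). -/

import Mathlib

open scoped RealInnerProductSpace Pointwise
open Metric

noncomputable section

/-- Euclidean space ℝ^n. -/
abbrev Euc (n : ℕ) := EuclideanSpace ℝ (Fin n)

/-- The image of a closed polygon with vertices `q 0, …, q (m-1)` (indices mod `m`):
the union of the segments `[q i, q (i+1)]`. -/
def polyImage {n m : ℕ} [NeZero m] (q : Fin m → Euc n) : Set (Euc n) :=
  ⋃ i : Fin m, segment ℝ (q i) (q (i + 1))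

/-- The length of a closed polygon: `∑ i, ‖q (i+1) - q i‖`. -/
noncomputable def polyLength {n m : ℕ} [NeZero m] (q : Fin m → Euc n) : ℝ :=
  ∑ i : Fin m, ‖q (i + 1) - q i‖

/-- A convex body: a compact convex set with nonempty interior. -/
def IsConvexBody {n : ℕ} (K : Set (Euc n)) : Prop :=
  IsCompact K ∧ Convex ℝ K ∧ (interior K).Nonempty

/-- A closed polygon belongs to `𝒫⁺(K)` if no translate of its image is contained
in the interior of `K`. -/
def InPPlus {n m : ℕ} [NeZero m] (K : Set (Euc n)) (q : Fin m → Euc n) : Prop :=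
  ∀ x : Euc n, ¬ ((fun p => p + x) '' polyImage q ⊆ interior K)

/-- Unit direction of the `i`-th edge of a closed polygon. -/
noncomputable def dir {n m : ℕ} [NeZero m] (q : Fin m → Euc n) (i : Fin m) : Euc n :=
  ‖q (i + 1) - q i‖⁻¹ • (q (i + 1) - q i)

/-- Outer normal `ν i = u (i-1) - u i` at the `i`-th vertex. -/
noncomputable def normalVec {n m : ℕ} [NeZero m] (q : Fin m → Euc n) (i : Fin m) : Euc n :=
  dir q (i - 1) - dir q i

/-- A periodic billiard trajectory on a convex body `K`. -/
def IsBilliard {n m : ℕ} [NeZero m] (K : Set (Euc n)) (q : Fin m → Euc n) : Prop :=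
  2 ≤ m ∧ (∀ i, q (i + 1) ≠ q i) ∧ (∀ i, q i ∈ K) ∧
    ∀ i, normalVec q i ≠ 0 ∧ ∀ x ∈ K, ⟪x - q i, normalVec q i⟫ ≤ 0

/-- The infimum of lengths of periodic billiard trajectories on `K`. -/
noncomputable def muP {n : ℕ} (K : Set (Euc n)) : ℝ :=
  sInf {L : ℝ | ∃ (m : ℕ) (hm : NeZero m) (q : Fin m → Euc n),
    @IsBilliard n m hm K q ∧ @polyLength n m hm q = L}

/-- No translate of the family of points `q` lies in the interior of `K`. -/
def NotTranslatable {n : ℕ} {ι : Type*} (K : Set (Euc n)) (q : ι → Euc n) : Prop :=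
  ∀ x : Euc n, ¬ ∀ i, q i + x ∈ interior K

section Normals

variable {n : ℕ} {K : Set (Euc n)}

lemma inner_neg_of_mem_interior {q ν x : Euc n} (hν : ν ≠ 0)
    (h : ∀ y ∈ K, ⟪y - q, ν⟫ ≤ 0) (hx : x ∈ interior K) : ⟪x - q, ν⟫ < 0 := by
  have hnhds : ∀ᶠ t : ℝ in nhds 0, x + t • ν ∈ interior K := by
    have hc : Continuous fun t : ℝ => x + t • ν := by fun_prop
    exact hc.continuousAt.eventually_mem (isOpen_interior.mem_nhds (by simpa using hx))
  obtain ⟨ε, hε, hball⟩ := Metric.eventually_nhds_iff.1 hnhds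
  have hmem := h _ (interior_subset (hball (y := ε / 2) (by
    rw [Real.dist_eq, sub_zero, abs_of_pos (by positivity)]; linarith)))
  rw [add_sub_right_comm, inner_add_left, real_inner_smul_left, real_inner_self_eq_norm_sq] at hmem
  have : 0 < ε / 2 * ‖ν‖ ^ 2 := by have := norm_pos_iff.2 hν; positivity
  linarith

variable {ι : Type*} [Fintype ι]

lemma notTranslatable_of_normals {q p ν : ι → Euc n}
    (hsum : ∑ i, ν i = 0) (hne : ∃ i, ν i ≠ 0) (h : ∀ i, ∀ y ∈ K, ⟪y - q i, ν i⟫ ≤ 0)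
    (hp : 0 ≤ ∑ i, ⟪p i - q i, ν i⟫) : NotTranslatable K p := by
  intro x hx
  have hlt : ∑ i, ⟪p i + x - q i, ν i⟫ < ∑ _i : ι, (0 : ℝ) := by
    obtain ⟨j, hj⟩ := hne
    exact Finset.sum_lt_sum (fun i _ => h i _ (interior_subset (hx i)))
      ⟨j, Finset.mem_univ j, inner_neg_of_mem_interior hj (h j) (hx j)⟩
  have heq : ∑ i, ⟪p i + x - q i, ν i⟫ = ∑ i, ⟪p i - q i, ν i⟫ := by
    simp only [add_sub_right_comm, inner_add_left, Finset.sum_add_distrib]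
    rw [← inner_sum, hsum, inner_zero_right, add_zero]
  rw [heq, Finset.sum_const_zero] at hlt
  linarith

lemma exists_normals_of_notTranslatable (hK : IsConvexBody K) {q : ι → Euc n}
    (hqK : ∀ i, q i ∈ K) (hq : NotTranslatable K q) :
    ∃ ν : ι → Euc n, ∑ i, ν i = 0 ∧ (∃ i, ν i ≠ 0) ∧ ∀ i, ∀ y ∈ K, ⟪y - q i, ν i⟫ ≤ 0 := by
  classical
  obtain ⟨hcomp, hconv, x₀, hx₀⟩ := hK
  obtain ⟨f, u, hf, hu⟩ := geometric_hahn_banach_open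
    (s := Set.univ.pi fun _ : ι => interior K)
    (t := Set.range fun (x : Euc n) (i : ι) => q i + x)
    (convex_pi fun _ _ => hconv.interior)
    (isOpen_set_pi Set.finite_univ fun _ _ => isOpen_interior)
    (by
      rintro _ ⟨x, rfl⟩ _ ⟨y, rfl⟩ a b _ _ hab
      refine ⟨a • x + b • y, funext fun i => ?_⟩
      simp only [Pi.add_apply, Pi.smul_apply, smul_add]
      rw [add_add_add_comm, ← add_smul, hab, one_smul])
    (by
      rw [Set.disjoint_left]
      rintro _ hmem ⟨x, rfl⟩
      exact hq x fun i => hmem i (Set.mem_univ i))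
  set ν : ι → Euc n := fun i =>
    (InnerProductSpace.toDual ℝ (Euc n)).symm
      (f.comp (ContinuousLinearMap.single ℝ (fun _ : ι => Euc n) i)) with hν
  have hνf : ∀ i y, ⟪y, ν i⟫ = f (Pi.single i y) := by
    intro i y
    rw [real_inner_comm, hν, InnerProductSpace.toDual_symm_apply]
    rfl
  have hfν : ∀ y : ι → Euc n, f y = ∑ i, ⟪y i, ν i⟫ := by
    intro y
    simp only [hνf]
    rw [← map_sum, Finset.univ_sum_single]
  have hdiag : ∀ x : Euc n, u ≤ f q + ⟪x, ∑ i, ν i⟫ := by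
    intro x
    have := hu _ ⟨x, rfl⟩
    rwa [hfν, Finset.sum_congr rfl fun i _ => inner_add_left (q i) x (ν i),
      Finset.sum_add_distrib, ← hfν, ← inner_sum] at this
  have hzero : ∑ i, ν i = 0 := by
    by_contra hne
    have hpos : 0 < ‖∑ i, ν i‖ ^ 2 := by have := norm_pos_iff.2 hne; positivity
    have := hdiag (((u - f q - 1) / ‖∑ i, ν i‖ ^ 2) • ∑ i, ν i)
    rw [real_inner_smul_left, real_inner_self_eq_norm_sq, div_mul_cancel₀ _ hpos.ne'] at this
    linarith
  have huq : u ≤ f q := by simpa using hdiag 0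
  refine ⟨ν, hzero, ?_, fun i y hy => ?_⟩
  · by_contra! hall
    have h1 := hf (fun _ => x₀) fun _ _ => hx₀
    rw [hfν] at h1
    rw [hfν] at huq
    simp only [hall, inner_zero_right, Finset.sum_const_zero] at h1 huq
    linarith
  · have hclosure : ∀ z : ι → Euc n, (∀ j, z j ∈ K) → f z ≤ u := by
      intro z hz
      have hzc : z ∈ closure (Set.univ.pi fun _ : ι => interior K) := by
        rw [closure_pi_set,
          hconv.closure_interior_eq_closure_of_nonempty_interior ⟨x₀, hx₀⟩]
        exact fun j _ => subset_closure (hz j)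
      exact closure_minimal (fun a ha => (hf a ha).le)
        (isClosed_le f.continuous continuous_const) hzc
    have hup := hclosure (q + Pi.single i (y - q i)) (fun j => by
      by_cases hji : j = i
      · subst hji; simpa using hy
      · simpa [hji] using hqK j)
    rw [map_add, ← hνf] at hup
    linarith

end Normals

section Polygons

variable {n : ℕ}

lemma polyLength_nonneg {m : ℕ} [NeZero m] (q : Fin m → Euc n) : 0 ≤ polyLength q :=
  Finset.sum_nonneg fun _ _ => norm_nonneg _

lemma continuous_polyLength {m : ℕ} [NeZero m] :
    Continuous (polyLength : (Fin m → Euc n) → ℝ) := by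
  unfold polyLength
  fun_prop

lemma polyLength_add_const {m : ℕ} [NeZero m] (q : Fin m → Euc n) (x : Euc n) :
    polyLength (fun i => q i + x) = polyLength q := by
  simp [polyLength]

lemma polyLength_smul {m : ℕ} [NeZero m] (q : Fin m → Euc n) {t : ℝ} (ht : 0 ≤ t) :
    polyLength (fun i => t • q i) = t * polyLength q := by
  simp [polyLength, ← smul_sub, norm_smul, abs_of_nonneg ht, Finset.mul_sum]

lemma polyLength_rotate {m : ℕ} [NeZero m] (q : Fin m → Euc n) (j : Fin m) :
    polyLength (fun i => q (i + j)) = polyLength q := by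
  unfold polyLength
  rw [← Equiv.sum_comp (Equiv.addRight j) fun i => ‖q (i + 1) - q i‖]
  simp [add_right_comm]

lemma polyLength_succ {k : ℕ} (q : Fin (k + 1) → Euc n) :
    polyLength q =
      ∑ i : Fin k, ‖q i.succ - q i.castSucc‖ + ‖q 0 - q (Fin.last k)‖ := by
  simp [polyLength, Fin.sum_univ_castSucc]

lemma polyLength_castSucc_le {k : ℕ} (q : Fin (k + 2) → Euc n) :
    polyLength (fun i : Fin (k + 1) => q i.castSucc) ≤ polyLength q := by
  rw [polyLength_succ, polyLength_succ q, Fin.sum_univ_castSucc]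
  have := norm_sub_le_norm_sub_add_norm_sub (q 0) (q (Fin.last (k + 1))) (q (Fin.last k).castSucc)
  simp only [Fin.succ_castSucc, Fin.succ_last, Fin.castSucc_zero]
  linarith

lemma norm_sub_le_polyLength {m : ℕ} [NeZero m] (q : Fin m → Euc n) (i : Fin m) :
    ‖q (i + 1) - q i‖ ≤ polyLength q :=
  Finset.single_le_sum (f := fun i => ‖q (i + 1) - q i‖) (fun _ _ => norm_nonneg _)
    (Finset.mem_univ i)

lemma norm_sub_zero_le_polyLength {k : ℕ} (q : Fin (k + 1) → Euc n) (i : Fin (k + 1)) :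
    ‖q i - q 0‖ ≤ i * polyLength q := by
  induction i using Fin.induction with
  | zero => simp
  | succ i ih =>
    have h1 := norm_sub_le_polyLength q i.castSucc
    have h2 := norm_sub_le_norm_sub_add_norm_sub (q i.succ) (q i.castSucc) (q 0)
    rw [Fin.coeSucc_eq_succ] at h1
    simp only [Fin.val_castSucc] at ih
    rw [Fin.val_succ]
    push_cast
    linarith

lemma sum_normalVec {m : ℕ} [NeZero m] (q : Fin m → Euc n) : ∑ i, normalVec q i = 0 := by
  simp only [normalVec, Finset.sum_sub_distrib]
  exact sub_eq_zero.2 (Equiv.sum_comp (Equiv.subRight (1 : Fin m)) (dir q))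

lemma IsBilliard.notTranslatable {m : ℕ} [NeZero m] {K : Set (Euc n)} {q : Fin m → Euc n}
    (h : IsBilliard K q) : NotTranslatable K q :=
  notTranslatable_of_normals (sum_normalVec q) ⟨0, (h.2.2.2 0).1⟩ (fun i => (h.2.2.2 i).2)
    (by simp)

lemma norm_add_le_of_ne_zero {E : Type*} [NormedAddCommGroup E] [InnerProductSpace ℝ E]
    {a : E} (ha : a ≠ 0) (b : E) :
    ‖a + b‖ ≤ ‖a‖ + ⟪‖a‖⁻¹ • a, b⟫ + ‖b‖ ^ 2 / (2 * ‖a‖) := by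
  have hpos := norm_pos_iff.2 ha
  have hsq := norm_add_sq_real a b
  have hrw : ‖a‖ + ⟪‖a‖⁻¹ • a, b⟫ + ‖b‖ ^ 2 / (2 * ‖a‖) =
      (‖a‖ ^ 2 + ‖a + b‖ ^ 2) / (2 * ‖a‖) := by
    rw [hsq, real_inner_smul_left]
    field_simp
    ring
  rw [hrw, le_div_iff₀ (by positivity)]
  nlinarith [sq_nonneg (‖a‖ - ‖a + b‖)]

lemma exists_polyLength_add_smul_le {m : ℕ} [NeZero m] {q : Fin m → Euc n}
    (hq : ∀ i, q (i + 1) ≠ q i) (v : Fin m → Euc n) :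
    ∃ C : ℝ, ∀ t : ℝ, polyLength (q + t • v) ≤
      polyLength q + t * ∑ i, ⟪v i, normalVec q i⟫ + t ^ 2 * C := by
  refine ⟨∑ i, ‖v (i + 1) - v i‖ ^ 2 / (2 * ‖q (i + 1) - q i‖), fun t => ?_⟩
  have hparts : ∑ i, ⟪v i, normalVec q i⟫ = ∑ i, ⟪dir q i, v (i + 1) - v i⟫ := by
    simp only [normalVec, inner_sub_right, Finset.sum_sub_distrib]
    rw [← Equiv.sum_comp (Equiv.addRight (1 : Fin m)) fun i => ⟪v i, dir q (i - 1)⟫]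
    simp [real_inner_comm]
  rw [hparts]
  simp only [polyLength, Finset.mul_sum, ← Finset.sum_add_distrib]
  refine Finset.sum_le_sum fun i _ => ?_
  have h := norm_add_le_of_ne_zero (sub_ne_zero.2 (hq i)) (t • (v (i + 1) - v i))
  rw [real_inner_smul_right, norm_smul, mul_pow, Real.norm_eq_abs, sq_abs, mul_div_assoc] at h
  have hadd : (q + t • v) (i + 1) - (q + t • v) i =
      q (i + 1) - q i + t • (v (i + 1) - v i) := by
    simp only [Pi.add_apply, Pi.smul_apply, smul_sub]
    abel
  rw [hadd]
  exact h

lemma nonneg_of_forall_pos_linear_add_sq {D C : ℝ} (h : ∀ t > 0, 0 ≤ t * D + t ^ 2 * C) :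
    0 ≤ D := by
  by_contra! hD
  have hC : 0 < |C| + 1 := by positivity
  have ht : 0 < -D / (|C| + 1) / 2 := by
    have : 0 < -D := by linarith
    positivity
  have := h _ ht
  set t := -D / (|C| + 1) / 2 with htdef
  have htC : t * (|C| + 1) = -D / 2 := by rw [htdef]; field_simp
  have h1 : 0 ≤ t * (D + t * C) := by linarith
  have h2 := nonneg_of_mul_nonneg_right h1 ht
  nlinarith [le_abs_self C]

/-- If `q` minimizes the length over a half-space of polygons with normal `ν`,
its reflection vectors are a nonnegative multiple of `ν`. -/
lemma exists_normalVec_eq_smul {m : ℕ} [NeZero m] {q ν : Fin m → Euc n}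
    (hq : ∀ i, q (i + 1) ≠ q i) (hν : ∃ i, ν i ≠ 0)
    (hmin : ∀ p : Fin m → Euc n, 0 ≤ ∑ i, ⟪p i - q i, ν i⟫ → polyLength q ≤ polyLength p) :
    ∃ c : ℝ, 0 ≤ c ∧ ∀ i, normalVec q i = c • ν i := by
  have hvar : ∀ v : Fin m → Euc n, 0 ≤ ∑ i, ⟪v i, ν i⟫ → 0 ≤ ∑ i, ⟪v i, normalVec q i⟫ := by
    intro v hv
    obtain ⟨C, hC⟩ := exists_polyLength_add_smul_le hq v
    refine nonneg_of_forall_pos_linear_add_sq (C := C) fun t ht => ?_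
    have h1 := hmin (q + t • v) (by
      simp only [Pi.add_apply, Pi.smul_apply, add_sub_cancel_left, real_inner_smul_left,
        ← Finset.mul_sum]
      positivity)
    linarith [hC t]
  have hN : 0 < ∑ i, ‖ν i‖ ^ 2 := by
    obtain ⟨j, hj⟩ := hν
    exact Finset.sum_pos' (fun i _ => by positivity)
      ⟨j, Finset.mem_univ j, by have := norm_pos_iff.2 hj; positivity⟩
  set c := (∑ i, ⟪ν i, normalVec q i⟫) / ∑ i, ‖ν i‖ ^ 2 with hc
  have hcN : c * ∑ i, ‖ν i‖ ^ 2 = ∑ i, ⟪ν i, normalVec q i⟫ := div_mul_cancel₀ _ hN.ne'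
  have horth : ∑ i, ⟪c • ν i - normalVec q i, ν i⟫ = 0 := by
    simp only [inner_sub_left, real_inner_smul_left, real_inner_self_eq_norm_sq,
      Finset.sum_sub_distrib, ← Finset.mul_sum, hcN]
    simp [real_inner_comm]
  have hdesc := hvar (fun i => c • ν i - normalVec q i) horth.ge
  have hle : ∑ i, ‖c • ν i - normalVec q i‖ ^ 2 ≤ 0 := by
    have : ∑ i, ‖c • ν i - normalVec q i‖ ^ 2 =
        c * ∑ i, ⟪c • ν i - normalVec q i, ν i⟫ -
          ∑ i, ⟪c • ν i - normalVec q i, normalVec q i⟫ := by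
      rw [Finset.mul_sum, ← Finset.sum_sub_distrib]
      refine Finset.sum_congr rfl fun i _ => ?_
      rw [← real_inner_smul_right, ← inner_sub_right, real_inner_self_eq_norm_sq]
    rw [this, horth]
    linarith
  refine ⟨c, div_nonneg (hvar ν (Finset.sum_nonneg fun i _ => real_inner_self_nonneg)) hN.le,
    fun i => ?_⟩
  have hz := (Finset.sum_eq_zero_iff_of_nonneg (fun i _ => by positivity)).1
    (le_antisymm hle (Finset.sum_nonneg fun i _ => by positivity)) i (Finset.mem_univ i)
  exact (sub_eq_zero.1 (norm_eq_zero.1 (pow_eq_zero_iff two_ne_zero |>.1 hz))).symm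

lemma exists_normalVec_ne_zero {m : ℕ} [NeZero m] {q : Fin m → Euc n}
    (hq : ∀ i, q (i + 1) ≠ q i) : ∃ i, normalVec q i ≠ 0 := by
  by_contra! h
  obtain ⟨k, rfl⟩ := Nat.exists_eq_succ_of_ne_zero (NeZero.ne m)
  have hstep : ∀ i : Fin (k + 1), dir q i = dir q 0 := by
    intro i
    induction i using Fin.induction with
    | zero => rfl
    | succ i ih =>
      have := sub_eq_zero.1 (h i.succ)
      rw [← Fin.coeSucc_eq_succ, add_sub_cancel_right] at this
      rw [← Fin.coeSucc_eq_succ, ← this, ih]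
  have hedge : ∀ i : Fin (k + 1), q (i + 1) - q i = ‖q (i + 1) - q i‖ • dir q 0 := by
    intro i
    rw [← hstep i, dir, smul_smul, mul_inv_cancel₀ (norm_ne_zero_iff.2 (sub_ne_zero.2 (hq i))),
      one_smul]
  have hsum : ∑ i : Fin (k + 1), (q (i + 1) - q i) = 0 := by
    rw [Finset.sum_sub_distrib]
    exact sub_eq_zero.2 (Equiv.sum_comp (Equiv.addRight (1 : Fin (k + 1))) q)
  rw [Finset.sum_congr rfl fun i _ => hedge i, ← Finset.sum_smul] at hsum
  have hlen : 0 < ∑ i : Fin (k + 1), ‖q (i + 1) - q i‖ :=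
    Finset.sum_pos (fun i _ => norm_pos_iff.2 (sub_ne_zero.2 (hq i))) Finset.univ_nonempty
  rcases smul_eq_zero.1 hsum with h0 | h0
  · exact hlen.ne' h0
  · exact sub_ne_zero.2 (hq 0) (by rw [hedge 0, h0, smul_zero])

end Polygons

section Minimizers

variable {n : ℕ} {K : Set (Euc n)}

lemma NotTranslatable.add_const {ι : Type*} {q : ι → Euc n} (h : NotTranslatable K q)
    (x : Euc n) : NotTranslatable K fun i => q i + x :=
  fun y hy => h (x + y) fun i => by simpa [add_assoc] using hy i

lemma isClosed_notTranslatable {ι : Type*} [Finite ι] :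
    IsClosed {q : ι → Euc n | NotTranslatable K q} := by
  have : {q : ι → Euc n | NotTranslatable K q} =
      ⋂ x : Euc n, {q | ∀ i, q i + x ∈ interior K}ᶜ := by
    ext q; simp [NotTranslatable]
  rw [this]
  refine isClosed_iInter fun x => IsOpen.isClosed_compl ?_
  simp only [Set.ofPred_forall]
  exact isOpen_iInter_of_finite fun i => isOpen_interior.preimage (by fun_prop)

lemma NotTranslatable.polyLength_pos (hK : (interior K).Nonempty) {k : ℕ}
    {q : Fin (k + 1) → Euc n} (h : NotTranslatable K q) : 0 < polyLength q := by
  refine (polyLength_nonneg q).lt_of_ne' fun h0 => ?_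
  obtain ⟨x, hx⟩ := hK
  refine h (x - q 0) fun i => ?_
  have := norm_sub_zero_le_polyLength q i
  rw [h0, mul_zero, norm_le_zero_iff] at this
  rwa [add_sub_left_comm, this, add_zero]

lemma exists_polyLength_minimizer {k : ℕ} {q : Fin (k + 1) → Euc n}
    (h : NotTranslatable K q) :
    ∃ p : Fin (k + 1) → Euc n, NotTranslatable K p ∧
      ∀ r : Fin (k + 1) → Euc n, NotTranslatable K r → polyLength p ≤ polyLength r := by
  set S : Set (Fin (k + 1) → Euc n) :=
    {p | NotTranslatable K p} ∩ ({p | p 0 = 0} ∩ {p | polyLength p ≤ polyLength q}) with hS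
  have hclosed : IsClosed S :=
    isClosed_notTranslatable.inter ((isClosed_eq (continuous_apply 0) continuous_const).inter
      (isClosed_le continuous_polyLength continuous_const))
  have hbdd : Bornology.IsBounded S := by
    refine isBounded_iff_forall_norm_le.2 ⟨(k + 1) * polyLength q, ?_⟩
    rintro p ⟨-, hp0, hpq⟩
    have hq0 := polyLength_nonneg q
    refine (pi_norm_le_iff_of_nonneg (by positivity)).2 fun i => ?_
    have h1 := norm_sub_zero_le_polyLength p i
    rw [show p 0 = 0 from hp0, sub_zero] at h1
    refine h1.trans (mul_le_mul ?_ hpq (polyLength_nonneg p) (by positivity))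
    exact_mod_cast i.isLt.le
  have hnorm : ∀ r : Fin (k + 1) → Euc n, NotTranslatable K r → polyLength r ≤ polyLength q →
      (fun i => r i + -r 0) ∈ S := fun r hr hrq =>
    ⟨hr.add_const _, by simp, by simpa only [Set.mem_ofPred_eq, polyLength_add_const] using hrq⟩
  obtain ⟨p, hpS, hpmin⟩ := (Metric.isCompact_of_isClosed_isBounded hclosed hbdd).exists_isMinOn
    ⟨_, hnorm q h le_rfl⟩ continuous_polyLength.continuousOn
  refine ⟨p, hpS.1, fun r hr => ?_⟩
  rcases le_total (polyLength r) (polyLength q) with hrq | hrq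
  · simpa only [polyLength_add_const] using isMinOn_iff.1 hpmin _ (hnorm r hr hrq)
  · exact hpS.2.2.trans hrq

lemma exists_translate_mem_of_minimizer (hK : IsConvexBody K) {k : ℕ}
    {p : Fin (k + 1) → Euc n} (hp : NotTranslatable K p)
    (hmin : ∀ r : Fin (k + 1) → Euc n, NotTranslatable K r → polyLength p ≤ polyLength r) :
    ∃ x : Euc n, ∀ i, p i + x ∈ K := by
  have hpos := hp.polyLength_pos hK.2.2
  set t : ℕ → ℝ := fun j => 1 - 1 / ((j : ℝ) + 1) with ht
  have ht0 : ∀ j, 0 ≤ t j := fun j => by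
    have : 1 / ((j : ℝ) + 1) ≤ 1 := by
      rw [div_le_one (by positivity)]; linarith [Nat.cast_nonneg (α := ℝ) j]
    simp only [ht]; linarith
  have ht1 : ∀ j, t j < 1 := fun j => by
    have : 0 < 1 / ((j : ℝ) + 1) := by positivity
    simp only [ht]; linarith
  have htlim : Filter.Tendsto t Filter.atTop (nhds 1) := by
    simpa only [sub_zero] using
      (tendsto_one_div_add_atTop_nhds_zero_nat (𝕜 := ℝ)).const_sub (1 : ℝ)
  have hex : ∀ j, ∃ x : Euc n, ∀ i, t j • p i + x ∈ interior K := by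
    intro j
    by_contra hno
    have hnt : NotTranslatable K fun i => t j • p i := fun x hx => hno ⟨x, hx⟩
    have := hmin _ hnt
    rw [polyLength_smul p (ht0 j)] at this
    nlinarith [ht1 j]
  choose x hx using hex
  obtain ⟨y, -, φ, hφ, hlim⟩ := hK.1.tendsto_subseq fun j => interior_subset (hx j 0)
  have htφ := htlim.comp hφ.tendsto_atTop
  refine ⟨y - p 0, fun i => ?_⟩
  refine hK.1.isClosed.mem_of_tendsto (b := Filter.atTop)
    (f := fun j => t (φ j) • p i + x (φ j)) ?_
    (Filter.Eventually.of_forall fun j => interior_subset (hx (φ j) i))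
  have hcomb := hlim.add (htφ.smul_const (p i - p 0))
  rw [one_smul] at hcomb
  convert hcomb using 2
  · simp only [Function.comp_apply, smul_sub]; abel
  · abel

/-- Every polygon that cannot be translated into the interior of `K` is at least as long as
some periodic billiard trajectory on `K`. -/
lemma exists_isBilliard_polyLength_le (hK : IsConvexBody K) {k : ℕ}
    {q : Fin (k + 1) → Euc n} (hq : NotTranslatable K q) :
    ∃ (m : ℕ) (_ : NeZero m) (p : Fin m → Euc n),
      IsBilliard K p ∧ polyLength p ≤ polyLength q := by
  classical
  have hP : ∃ l : ℕ, ∃ r : Fin (l + 1) → Euc n,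
      NotTranslatable K r ∧ polyLength r ≤ polyLength q := ⟨k, q, hq, le_rfl⟩
  obtain ⟨r, hr, hrq⟩ := Nat.find_spec hP
  have hfew := fun l (hl : l < Nat.find hP) => Nat.find_min hP hl
  generalize Nat.find hP = l at r hr hrq hfew
  obtain ⟨p₀, hp₀, hp₀min⟩ := exists_polyLength_minimizer hr
  obtain ⟨x, hx⟩ := exists_translate_mem_of_minimizer hK hp₀ hp₀min
  set p : Fin (l + 1) → Euc n := fun i => p₀ i + x
  have hp : NotTranslatable K p := hp₀.add_const x
  have hmin : ∀ r : Fin (l + 1) → Euc n, NotTranslatable K r → polyLength p ≤ polyLength r := by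
    simpa only [p, polyLength_add_const] using hp₀min
  have hpq : polyLength p ≤ polyLength q := (hmin r hr).trans hrq
  obtain ⟨ν, hνsum, hνne, hν⟩ := exists_normals_of_notTranslatable hK (q := p) hx hp
  -- Minimality of the number of vertices: deleting a vertex makes the polygon translatable.
  have hdel : ∀ j : Fin (l + 1), 0 < l → ∃ y : Euc n, ∀ i, i ≠ j → p i + y ∈ interior K := by
    intro j hl
    obtain ⟨l, rfl⟩ := Nat.exists_eq_succ_of_ne_zero hl.ne'
    by_contra! hno
    refine hfew l (Nat.lt_succ_self l)
      ⟨fun i => p (i.castSucc + (j - Fin.last (l + 1))), fun y hy => ?_, ?_⟩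
    · obtain ⟨i, hij, hi⟩ := hno y
      have hlast : i - (j - Fin.last (l + 1)) ≠ Fin.last (l + 1) := fun h => hij (by
        rw [sub_eq_iff_eq_add] at h; rw [h]; abel)
      obtain ⟨i', hi'⟩ := Fin.exists_castSucc_eq.2 hlast
      refine hi ?_
      simpa only [hi', sub_add_cancel] using hy i'
    · refine (polyLength_castSucc_le fun i => p (i + (j - Fin.last (l + 1)))).trans ?_
      rwa [polyLength_rotate]
  have hl : 0 < l := by
    by_contra hl0
    obtain rfl : l = 0 := by omega
    have := hp.polyLength_pos hK.2.2
    simp [polyLength, Fin.fin_one_eq_zero] at this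
  have hedge : ∀ i, p (i + 1) ≠ p i := by
    intro j hj
    obtain ⟨y, hy⟩ := hdel j hl
    refine hp y fun i => ?_
    by_cases hij : i = j
    · rw [hij, ← hj]
      exact hy _ fun h => hl.ne' (Nat.succ_injective (Fin.one_eq_zero_iff.1 (add_eq_left.1 h)))
    · exact hy i hij
  have hνall : ∀ i, ν i ≠ 0 := by
    intro j hj
    obtain ⟨y, hy⟩ := hdel j hl
    obtain ⟨z, hz⟩ := hK.2.2
    refine notTranslatable_of_normals (p := Function.update p j (z - y)) hνsum hνne hν
      (Finset.sum_nonneg fun i _ => ?_) y fun i => ?_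
    all_goals
      by_cases hij : i = j
      · subst hij; simp [hj, hz]
      · simp [hij, hy]
  obtain ⟨c, hc, hcν⟩ := exists_normalVec_eq_smul hedge hνne fun r hr =>
    hmin r (notTranslatable_of_normals hνsum hνne hν hr)
  have hcpos : 0 < c := by
    refine hc.lt_of_ne' ?_
    rintro rfl
    obtain ⟨i, hi⟩ := exists_normalVec_ne_zero hedge
    exact hi (by rw [hcν, zero_smul])
  refine ⟨l + 1, inferInstance, p, ⟨by omega, hedge, hx, fun i => ?_⟩, hpq⟩
  rw [hcν]
  refine ⟨smul_ne_zero hcpos.ne' (hνall i), fun y hy => ?_⟩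
  rw [real_inner_smul_right]
  exact mul_nonpos_of_nonneg_of_nonpos hc (hν i y hy)

end Minimizers

theorem stmt5 {n : ℕ} (K₁ K₂ : Set (Euc n))
    (hK₁ : IsConvexBody K₁) (hK₂ : IsConvexBody K₂) (hsub : K₁ ⊆ K₂)
    (hex₁ : ∃ (m : ℕ) (hm : NeZero m) (q : Fin m → Euc n), @IsBilliard n m hm K₁ q)
    (hex₂ : ∃ (m : ℕ) (hm : NeZero m) (q : Fin m → Euc n), @IsBilliard n m hm K₂ q) :
    muP K₁ ≤ muP K₂ := by
  obtain ⟨m₀, hm₀, q₀, hq₀⟩ := hex₂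
  refine le_csInf ⟨_, m₀, hm₀, q₀, hq₀, rfl⟩ ?_
  rintro _ ⟨m, hm, q, hq, rfl⟩
  have hnt : NotTranslatable K₁ q := fun x hx =>
    hq.notTranslatable x fun i => interior_mono hsub (hx i)
  obtain ⟨k, rfl⟩ := Nat.exists_eq_succ_of_ne_zero (NeZero.ne m)
  obtain ⟨l, hl, p, hp, hpq⟩ := exists_isBilliard_polyLength_le hK₁ hnt
  have hle : muP K₁ ≤ polyLength p := by
    refine csInf_le ⟨0, ?_⟩ ⟨l, hl, p, hp, rfl⟩
    rintro _ ⟨l, hl, p, -, rfl⟩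
    exact polyLength_nonneg p
  exact hle.trans hpq
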